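/- Let C be a plane curve of degree d over F_q without F_q-line components with N_q(C) = (d-1)q + 1 and d < q+1, no F_q-point of C singular, and suppose that every F_q-line of P^2 meets C(F_q) in exactly 0, 1, or d points. Then: (a) an F_q-line l with l ∩ C(F_q) nonempty meets C(F_q) in exactly 1 point if and only if l is the tangent line to C at an F_q-point of C; (b) the number of F_q-lines meeting C(F_q) in exactly 1 point is (d-1)q + 1, and the number of F_q-lines meeting C(F_q) in exactly d points is ((d-1)q + 1)q/d; consequently d ≤ √q + 1. -/

import Mathlib

open MvPolynomial

variable {K : Type} [Field K]

/-- The linear form `∑ aᵢ Xᵢ` as a multivariate polynomial. -/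
noncomputable def linForm {n : ℕ} (a : Fin n → K) : MvPolynomial (Fin n) K :=
  ∑ i, C (a i) * X i

/-- The linear form `v ↦ ∑ aᵢ vᵢ` as a linear map. -/
noncomputable def linMap {n : ℕ} (a : Fin n → K) : (Fin n → K) →ₗ[K] K :=
  ∑ i, a i • LinearMap.proj i

/-- Substitution `F(M·X)` of a linear change of variables into `F`. -/
noncomputable def substLin {n : ℕ} (M : Matrix (Fin n) (Fin n) K)
    (F : MvPolynomial (Fin n) K) : MvPolynomial (Fin n) K :=
  MvPolynomial.aeval (fun i => ∑ j, C (M i j) * X j) F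

/-- Projective equivalence over `K` of two forms. -/
def ProjEquiv {n : ℕ} (F G : MvPolynomial (Fin n) K) : Prop :=
  ∃ M : Matrix (Fin n) (Fin n) K, IsUnit M.det ∧
    ∃ c : K, c ≠ 0 ∧ substLin M F = C c * G

/-- An `F_q`-line in `P^3` (resp. `P^2`), as a 2-dimensional linear subspace. -/
def IsLine {n : ℕ} (W : Submodule K (Fin n → K)) : Prop := Module.finrank K W = 2

/-- An `F_q`-plane in `P^3`, as a 3-dimensional linear subspace. -/
def IsPlane (W : Submodule K (Fin 4 → K)) : Prop := Module.finrank K W = 3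

/-- The section `S ∩ H` of the surface `S = {F = 0}` with the plane `H` given by the
subspace `W` is a planar `F_q`-pencil of degree `d` with vertex `P`: modulo the linear
form defining `H`, `F` is a nonzero scalar times a product of `d` linear forms over `F_q`
cutting out `d` pairwise distinct lines of `H`, all passing through the point `P`. -/
def IsPencil (F : MvPolynomial (Fin 4) K) (d : ℕ)
    (W : Submodule K (Fin 4 → K)) (P : Projectivization K (Fin 4 → K)) : Prop :=
  ∃ (a : Fin 4 → K) (m : Fin d → Fin 4 → K) (c : K) (g : MvPolynomial (Fin 4) K),
    a ≠ 0 ∧ W = LinearMap.ker (linMap a) ∧ c ≠ 0 ∧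
    F = C c * (∏ i, linForm (m i)) + linForm a * g ∧
    (∀ i, IsLine (LinearMap.ker (linMap a) ⊓ LinearMap.ker (linMap (m i)))) ∧
    (∀ i j, i ≠ j →
      LinearMap.ker (linMap a) ⊓ LinearMap.ker (linMap (m i)) ≠
      LinearMap.ker (linMap a) ⊓ LinearMap.ker (linMap (m j))) ∧
    P.rep ∈ W ∧ (∀ i, linMap (m i) P.rep = 0)

/-- The restriction of `F` to the plane `H` given by the subspace `W` has a linear
factor over `F_q` (i.e. the section `S ∩ H` has an `F_q`-line component). -/
def SectionHasLineComp (F : MvPolynomial (Fin 4) K)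
    (W : Submodule K (Fin 4 → K)) : Prop :=
  ∃ (a b : Fin 4 → K) (h g : MvPolynomial (Fin 4) K),
    a ≠ 0 ∧ W = LinearMap.ker (linMap a) ∧
    IsLine (LinearMap.ker (linMap a) ⊓ LinearMap.ker (linMap b)) ∧
    F = linForm b * h + linForm a * g

open Configuration in
/-- Distinct points have a unique line through both of them. -/
theorem Configuration.HasLines.card_lines_through_pair {P L : Type*} [Membership P L]
    [HasLines P L] [Fintype L] [∀ (p : P) (l : L), Decidable (p ∈ l)] {p x : P} (h : p ≠ x) :
    (Finset.univ.filter fun l : L => p ∈ l ∧ x ∈ l).card = 1 := by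
  rw [Finset.card_eq_one]
  refine ⟨HasLines.mkLine h, ?_⟩
  ext l
  have h0 := HasLines.mkLine_ax (L := L) h
  simp only [Finset.mem_filter, Finset.mem_univ, true_and, Finset.mem_singleton]
  constructor
  · intro hl
    exact (Nondegenerate.eq_or_eq hl.1 hl.2 h0.1 h0.2).resolve_left h
  · rintro rfl
    exact h0

section ThreeIntersectionNumbers

open Configuration Finset

variable {P L : Type*} [Membership P L] [ProjectivePlane P L] [Fintype P] [Fintype L]
  [∀ (p : P) (l : L), Decidable (p ∈ l)]

theorem Configuration.ProjectivePlane.card_filter_lines (p : P) :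
    #{l : L | p ∈ l} = ProjectivePlane.order P L + 1 := by
  rw [← ProjectivePlane.lineCount_eq (L := L) p, lineCount, Nat.card_eq_fintype_card,
    Fintype.card_subtype]

theorem Configuration.ProjectivePlane.sum_card_inter_lines_through {S : Finset P} {p : P}
    (hp : p ∈ S) :
    ∑ l : L with p ∈ l, #{x ∈ S | x ∈ l} = #S + ProjectivePlane.order P L := by
  classical
  simp_rw [Finset.card_filter]
  rw [Finset.sum_comm, ← Finset.add_sum_erase S _ hp]
  have h1 : ∀ x ∈ S.erase p, (∑ l : L with p ∈ l, if x ∈ l then 1 else 0) = 1 := by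
    intro x hx
    rw [← Finset.card_filter, Finset.filter_filter]
    exact HasLines.card_lines_through_pair (Finset.ne_of_mem_erase hx).symm
  have h2 : (∑ l : L with p ∈ l, if p ∈ l then 1 else 0) = ProjectivePlane.order P L + 1 := by
    rw [← Finset.card_filter, Finset.filter_filter]
    simp only [and_self]
    exact ProjectivePlane.card_filter_lines p
  rw [Finset.sum_congr rfl h1, h2, Finset.sum_const, smul_eq_mul, mul_one,
    Finset.card_erase_of_mem hp]
  have := Finset.card_pos.mpr ⟨p, hp⟩
  omega

variable {S : Finset P} {d : ℕ}

theorem Configuration.ProjectivePlane.card_lines_through_of_inter (hd : 2 ≤ d)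
    (hS : #S = (d - 1) * ProjectivePlane.order P L + 1)
    (hm : ∀ l : L, #{x ∈ S | x ∈ l} = 0 ∨ #{x ∈ S | x ∈ l} = 1 ∨ #{x ∈ S | x ∈ l} = d)
    {p : P} (hp : p ∈ S) :
    #{l : L | p ∈ l ∧ #{x ∈ S | x ∈ l} = 1} = 1 ∧
      #{l : L | p ∈ l ∧ #{x ∈ S | x ∈ l} = d} = ProjectivePlane.order P L := by
  have hsum := ProjectivePlane.sum_card_inter_lines_through (L := L) hp
  have hcard := ProjectivePlane.card_filter_lines (L := L) p
  rw [← Finset.card_filter_add_card_filter_not (fun l : L => #{x ∈ S | x ∈ l} = 1)] at hcard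
  rw [← Finset.sum_filter_add_sum_filter_not _ (fun l : L => #{x ∈ S | x ∈ l} = 1)] at hsum
  have hnot : {l ∈ ({l : L | p ∈ l} : Finset L) | ¬ #{x ∈ S | x ∈ l} = 1} =
      ({l : L | p ∈ l ∧ #{x ∈ S | x ∈ l} = d} : Finset L) := by
    ext l
    simp only [Finset.mem_filter, Finset.mem_univ, true_and, and_congr_right_iff]
    intro hpl
    have : 0 < #{x ∈ S | x ∈ l} := Finset.card_pos.mpr ⟨p, by simp [hp, hpl]⟩
    have := hm l
    omega
  rw [hnot, Finset.filter_filter] at hcard hsum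
  have hsum' : ∀ k : ℕ, ∑ l : L with p ∈ l ∧ #{x ∈ S | x ∈ l} = k, #{x ∈ S | x ∈ l} =
      #{l : L | p ∈ l ∧ #{x ∈ S | x ∈ l} = k} * k := fun k =>
    Finset.sum_const_nat fun l hl => (Finset.mem_filter.mp hl).2.2
  rw [hsum', hsum', hS] at hsum
  obtain ⟨e, rfl⟩ : ∃ e, d = e + 1 := ⟨d - 1, by omega⟩
  have hb : #{l : L | p ∈ l ∧ #{x ∈ S | x ∈ l} = e + 1} = ProjectivePlane.order P L := by
    have he : 0 < e := by omega
    refine Nat.eq_of_mul_eq_mul_left he ?_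
    simp only [Nat.add_sub_cancel] at hsum
    linarith
  exact ⟨by omega, hb⟩

omit [ProjectivePlane P L] [Fintype P] in
theorem Configuration.ProjectivePlane.card_lines_mul_of_inter {k m : ℕ}
    (h : ∀ p ∈ S, #{l : L | p ∈ l ∧ #{x ∈ S | x ∈ l} = k} = m) :
    #{l : L | #{x ∈ S | x ∈ l} = k} * k = #S * m := by
  have := Finset.sum_card_bipartiteAbove_eq_sum_card_bipartiteBelow
    (s := S) (t := ({l : L | #{x ∈ S | x ∈ l} = k} : Finset L)) (fun p l => p ∈ l)
  simp only [Finset.bipartiteAbove, Finset.bipartiteBelow, Finset.filter_filter] at this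
  rw [Finset.sum_congr rfl (g := fun _ => m) (fun p hp => by
      rw [← h p hp]; congr 1; ext l; simp [and_comm]),
    Finset.sum_congr rfl (g := fun _ => k) (fun l hl => (Finset.mem_filter.mp hl).2),
    Finset.sum_const, Finset.sum_const, smul_eq_mul, smul_eq_mul] at this
  exact this.symm

theorem Configuration.ProjectivePlane.sq_sub_one_le_order (hd : 2 ≤ d)
    (hS : #S = (d - 1) * ProjectivePlane.order P L + 1)
    (hm : ∀ l : L, #{x ∈ S | x ∈ l} = 0 ∨ #{x ∈ S | x ∈ l} = 1 ∨ #{x ∈ S | x ∈ l} = d) :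
    (d - 1) ^ 2 ≤ ProjectivePlane.order P L := by
  classical
  have h1 := ProjectivePlane.card_lines_mul_of_inter (S := S) (L := L) (k := 1)
    (fun p hp => (ProjectivePlane.card_lines_through_of_inter hd hS hm hp).1)
  have h2 := ProjectivePlane.card_lines_mul_of_inter (S := S) (L := L) (k := d)
    (fun p hp => (ProjectivePlane.card_lines_through_of_inter hd hS hm hp).2)
  have hdisj : Disjoint ({l : L | #{x ∈ S | x ∈ l} = 1} : Finset L)
      ({l : L | #{x ∈ S | x ∈ l} = d} : Finset L) := by
    rw [Finset.disjoint_filter]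
    omega
  have hle := Finset.card_le_univ (({l : L | #{x ∈ S | x ∈ l} = 1} : Finset L) ∪
      ({l : L | #{x ∈ S | x ∈ l} = d} : Finset L))
  rw [Finset.card_union_of_disjoint hdisj, ProjectivePlane.card_lines P L] at hle
  have hq := ProjectivePlane.one_lt_order P L
  generalize ProjectivePlane.order P L = q at *
  obtain ⟨e, rfl⟩ : ∃ e, d = e + 1 := ⟨d - 1, by omega⟩
  simp only [Nat.add_sub_cancel] at *
  have h3 := Nat.mul_le_mul_right (e + 1) hle
  rw [add_mul, h2, mul_one] at *
  rw [h1, hS] at h3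
  refine Nat.le_of_mul_le_mul_right (c := q) ?_ (by omega)
  nlinarith

end ThreeIntersectionNumbers

section Restriction

/-- The restriction `G(u + tv)` of `G` to a parametrised affine line. -/
noncomputable def lineRestrict (u v : Fin 3 → K) (G : MvPolynomial (Fin 3) K) :
    Polynomial K :=
  aeval (fun i => Polynomial.C (u i) + Polynomial.X * Polynomial.C (v i)) G

theorem eval_lineRestrict (u v : Fin 3 → K) (G : MvPolynomial (Fin 3) K) (t : K) :
    (lineRestrict u v G).eval t = eval (u + t • v) G := by
  rw [lineRestrict, aeval_def, ← Polynomial.coe_evalRingHom, hom_eval₂]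
  have h : (Polynomial.evalRingHom t).comp (algebraMap K (Polynomial K)) = RingHom.id K := by
    ext; simp
  rw [h, eval₂_id]
  congr 2
  ext i
  simp [mul_comm (v i)]

theorem eval_zero_derivative_lineRestrict (u v : Fin 3 → K) (G : MvPolynomial (Fin 3) K) :
    (Polynomial.derivative (lineRestrict u v G)).eval 0 =
      ∑ i, eval u (pderiv i G) * v i := by
  induction G using MvPolynomial.induction_on with
  | C a => simp [lineRestrict]
  | add p q hp hq =>
    simp only [lineRestrict, map_add, Polynomial.eval_add, add_mul,
      Finset.sum_add_distrib] at *
    rw [hp, hq]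
  | mul_X p n hp =>
    have h0 := eval_lineRestrict u v p 0
    simp only [zero_smul, add_zero] at h0
    simp only [lineRestrict, map_mul, aeval_X, Polynomial.derivative_mul, Polynomial.eval_add,
      Polynomial.eval_mul, Derivation.leibniz, smul_eq_mul, map_add, eval_X] at *
    rw [hp, h0]
    simp [pderiv_X, Pi.single_apply, add_mul, Finset.sum_add_distrib, Finset.sum_mul, apply_ite]
    rw [add_comm]
    congr 1
    exact Finset.sum_congr rfl fun i _ => by ring

theorem natDegree_lineRestrict_le {d : ℕ} (u v : Fin 3 → K) {G : MvPolynomial (Fin 3) K}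
    (hG : G.IsHomogeneous d) : (lineRestrict u v G).natDegree ≤ d := by
  rw [lineRestrict, aeval_def, eval₂_eq']
  refine Polynomial.natDegree_sum_le_of_forall_le _ _ fun m hm => ?_
  have hdeg : m 0 + m 1 + m 2 = d := by
    rw [← hG (mem_support_iff.mp hm), Finsupp.weight_apply, Finsupp.sum_fintype _ _ (by simp),
      Fin.sum_univ_three]
    simp
  have hf : ∀ i, ((Polynomial.C (u i) + Polynomial.X * Polynomial.C (v i)) ^ m i).natDegree ≤
      m i := fun i => by compute_degree
  refine (Polynomial.natDegree_C_mul_le _ _).trans ?_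
  rw [Fin.prod_univ_three, ← hdeg]
  exact Polynomial.natDegree_mul_le_of_le (Polynomial.natDegree_mul_le_of_le (hf 0) (hf 1)) (hf 2)

theorem coeff_lineRestrict {d : ℕ} (u v : Fin 3 → K) {G : MvPolynomial (Fin 3) K}
    (hG : G.IsHomogeneous d) : (lineRestrict u v G).coeff d = eval v G := by
  rw [lineRestrict, aeval_def, eval₂_eq', Polynomial.finsetSum_coeff, eval_eq']
  refine Finset.sum_congr rfl fun m hm => ?_
  have hdeg : m 0 + m 1 + m 2 = d := by
    rw [← hG (mem_support_iff.mp hm), Finsupp.weight_apply, Finsupp.sum_fintype _ _ (by simp),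
      Fin.sum_univ_three]
    simp
  have hl : ∀ i, (Polynomial.C (u i) + Polynomial.X * Polynomial.C (v i)).natDegree ≤ 1 :=
    fun i => by compute_degree
  have hf : ∀ i, ((Polynomial.C (u i) + Polynomial.X * Polynomial.C (v i)) ^ m i).natDegree ≤
      m i := fun i => by compute_degree
  have hc : ∀ i, ((Polynomial.C (u i) + Polynomial.X * Polynomial.C (v i)) ^ m i).coeff (m i) =
      v i ^ m i := fun i => by
    have := Polynomial.coeff_pow_of_natDegree_le (m := m i) (hl i)
    rw [mul_one] at this
    rw [this]
    simp [Polynomial.coeff_C]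
  rw [Polynomial.algebraMap_eq, Polynomial.coeff_C_mul, Fin.prod_univ_three,
    Fin.prod_univ_three, ← hdeg,
    Polynomial.coeff_mul_add_eq_of_natDegree_le
      (Polynomial.natDegree_mul_le_of_le (hf 0) (hf 1)) (hf 2),
    Polynomial.coeff_mul_add_eq_of_natDegree_le (hf 0) (hf 1), hc, hc, hc]

theorem Polynomial.card_add_two_le_natDegree {g : Polynomial K} (hg : g ≠ 0)
    (h0 : g.eval 0 = 0) (h1 : (Polynomial.derivative g).eval 0 = 0) {T : Finset K}
    (hT : ∀ t ∈ T, t ≠ 0 ∧ g.eval t = 0) : T.card + 2 ≤ g.natDegree := by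
  classical
  obtain ⟨h, rfl⟩ : Polynomial.X ^ 2 ∣ g := by
    rw [Polynomial.X_pow_dvd_iff]
    intro k hk
    rw [← Polynomial.coeff_zero_eq_eval_zero] at h0 h1
    interval_cases k
    · exact h0
    · simpa [Polynomial.coeff_derivative] using h1
  have hh : h ≠ 0 := right_ne_zero_of_mul hg
  rw [Polynomial.natDegree_X_pow_mul _ hh]
  have hsub : T ⊆ h.roots.toFinset := fun t ht => by
    have := hT t ht
    simp_all
  have := Finset.card_le_card hsub
  have := Multiset.toFinset_card_le h.roots
  have := Polynomial.card_roots' h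
  omega

end Restriction

section PlaneLines

open Configuration Configuration.ofField Projectivization
open scoped LinearAlgebra.Projectivization

theorem linMap_apply {n : ℕ} (a v : Fin n → K) : linMap a v = a ⬝ᵥ v := by
  simp [linMap, dotProduct]

theorem linMap_ne_zero {n : ℕ} {a : Fin n → K} (ha : a ≠ 0) : linMap a ≠ 0 := by
  intro h
  refine ha (dotProduct_eq_zero a fun v => ?_)
  rw [← linMap_apply, h, LinearMap.zero_apply]

theorem isLine_ker_linMap {a : Fin 3 → K} (ha : a ≠ 0) :
    IsLine (LinearMap.ker (linMap a)) := by
  have := Module.Dual.finrank_ker_add_one_of_ne_zero (linMap_ne_zero ha)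
  rw [Module.finrank_fin_fun] at this
  rw [IsLine]
  omega

theorem mem_iff_mk_rep_mem {l : Submodule K (Fin 3 → K)} {v : Fin 3 → K} (hv : v ≠ 0) :
    (mk K v hv).rep ∈ l ↔ v ∈ l := by
  obtain ⟨a, ha⟩ := exists_smul_eq_mk_rep K v hv
  rw [← ha]
  exact Submodule.smul_mem_iff_of_isUnit l a.isUnit

theorem MvPolynomial.IsHomogeneous.eval_smul {σ : Type*} [Fintype σ] {d : ℕ}
    {G : MvPolynomial σ K} (hG : G.IsHomogeneous d) (c : K) (v : σ → K) :
    eval (c • v) G = c ^ d * eval v G := by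
  rw [eval_eq', eval_eq', Finset.mul_sum]
  refine Finset.sum_congr rfl fun m hm => ?_
  have hdeg : ∑ i, m i = d := by
    rw [← hG (mem_support_iff.mp hm), Finsupp.weight_apply, Finsupp.sum_fintype _ _ (by simp)]
    simp
  simp only [Pi.smul_apply, smul_eq_mul, mul_pow, Finset.prod_mul_distrib,
    Finset.prod_pow_eq_pow_sum, hdeg]
  ring

theorem eval_mk_rep_eq_zero_iff {d : ℕ} {G : MvPolynomial (Fin 3) K} (hG : G.IsHomogeneous d)
    {v : Fin 3 → K} (hv : v ≠ 0) : eval (mk K v hv).rep G = 0 ↔ eval v G = 0 := by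
  obtain ⟨a, ha⟩ := exists_smul_eq_mk_rep K v hv
  rw [← ha, Units.smul_def, hG.eval_smul]
  simp

/-- The linear subspace of the line with coefficient vector `w`. -/
noncomputable def planeLine (w : ℙ K (Fin 3 → K)) : Submodule K (Fin 3 → K) :=
  LinearMap.ker (linMap w.rep)

theorem isLine_planeLine (w : ℙ K (Fin 3 → K)) : IsLine (planeLine w) :=
  isLine_ker_linMap w.rep_nonzero

theorem rep_mem_planeLine {p w : ℙ K (Fin 3 → K)} : p.rep ∈ planeLine w ↔ p ∈ w := by
  rw [planeLine, LinearMap.mem_ker, linMap_apply, dotProduct_comm, mem_iff]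
  conv_rhs => rw [← p.mk_rep, ← w.mk_rep]
  rw [orthogonal_mk]

theorem exists_planeLine_eq {l : Submodule K (Fin 3 → K)} (hl : IsLine l) :
    ∃ w, planeLine w = l := by
  have hlt : l < ⊤ := by
    refine lt_top_iff_ne_top.mpr ?_
    rintro rfl
    rw [IsLine, finrank_top, Module.finrank_fin_fun] at hl
    omega
  obtain ⟨f, hf, hle⟩ := Submodule.exists_le_ker_of_lt_top l hlt
  set a : Fin 3 → K := fun i => f (Pi.single i 1) with ha
  have hfa : f = linMap a := by
    refine LinearMap.pi_ext' fun i => LinearMap.ext_ring ?_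
    simp [linMap_apply, ha]
  have ha0 : a ≠ 0 := by
    intro h
    rw [h] at hfa
    refine hf (hfa.trans ?_)
    ext; simp [linMap_apply]
  refine ⟨mk K a ha0, ?_⟩
  obtain ⟨c, hc⟩ := exists_smul_eq_mk_rep K a ha0
  symm
  refine Submodule.eq_of_le_of_finrank_eq (fun v hv => ?_) ?_
  · have h0 : f v = 0 := hle hv
    rw [hfa, linMap_apply] at h0
    rw [planeLine, LinearMap.mem_ker, linMap_apply, ← hc, smul_dotProduct, h0, smul_zero]
  · exact Eq.trans hl (isLine_planeLine _).symm

theorem span_pair_rep_eq {l : Submodule K (Fin 3 → K)} (hl : IsLine l)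
    {p r : ℙ K (Fin 3 → K)} (hpr : p ≠ r) (hp : p.rep ∈ l) (hr : r.rep ∈ l) :
    Submodule.span K {p.rep, r.rep} = l := by
  have hli : LinearIndependent K ![p.rep, r.rep] := by
    rw [← p.mk_rep, ← r.mk_rep, ne_eq, mk_eq_mk_iff_crossProduct_eq_zero] at hpr
    exact crossProduct_ne_zero_iff_linearIndependent.mp hpr
  refine Submodule.eq_of_le_of_finrank_eq ?_ ?_
  · rw [Submodule.span_le]
    rintro x (rfl | rfl)
    exacts [hp, hr]
  · have := finrank_span_eq_card hli
    rw [Matrix.range_cons_cons_empty, Fintype.card_fin] at this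
    exact this.trans hl.symm

variable [Fintype K] [DecidableEq K]

theorem order_projectivization :
    ProjectivePlane.order (ℙ K (Fin 3 → K)) (ℙ K (Fin 3 → K)) = Fintype.card K := by
  have : Fintype (ℙ K (Fin 3 → K)) := Fintype.ofFinite _
  have h1 := ProjectivePlane.card_points (ℙ K (Fin 3 → K)) (ℙ K (Fin 3 → K))
  have h2 := Projectivization.card_of_finrank K (Fin 3 → K) (n := 3) (Module.finrank_fin_fun K)
  rw [Nat.card_eq_fintype_card, h1, Nat.card_eq_fintype_card] at h2
  simp only [Finset.sum_range_succ, Finset.sum_range_zero] at h2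
  generalize ProjectivePlane.order (ℙ K (Fin 3 → K)) (ℙ K (Fin 3 → K)) = m at *
  rcases lt_trichotomy m (Fintype.card K) with h | h | h
  · nlinarith
  · exact h
  · nlinarith

theorem planeLine_injective : Function.Injective (planeLine (K := K)) := by
  intro w w' h
  have hc := ProjectivePlane.pointCount_eq (ℙ K (Fin 3 → K)) w
  rw [pointCount] at hc
  have hpos := ProjectivePlane.one_lt_order (ℙ K (Fin 3 → K)) (ℙ K (Fin 3 → K))
  have hnt : Nontrivial {p : ℙ K (Fin 3 → K) // p ∈ w} := by
    rw [← Finite.one_lt_card_iff_nontrivial]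
    omega
  obtain ⟨⟨p, hp⟩, ⟨r, hr⟩, hpr⟩ := hnt
  have hmem : ∀ x, x ∈ w → x ∈ w' := fun x hx => by
    rw [← rep_mem_planeLine, ← h, rep_mem_planeLine]
    exact hx
  exact (Nondegenerate.eq_or_eq hp hr (hmem p hp) (hmem r hr)).resolve_left
    fun he => hpr (Subtype.ext he)

theorem card_isLine_and (Q : Submodule K (Fin 3 → K) → Prop) :
    Nat.card {l : Submodule K (Fin 3 → K) // IsLine l ∧ Q l} =
      Nat.card {w : ℙ K (Fin 3 → K) // Q (planeLine w)} := by
  symm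
  refine Nat.card_congr (Equiv.ofBijective
    (fun w => ⟨planeLine w.1, isLine_planeLine w.1, w.2⟩) ⟨fun w w' h => ?_, fun l => ?_⟩)
  · exact Subtype.ext (planeLine_injective (congrArg Subtype.val h))
  · obtain ⟨l, hl, hQ⟩ := l
    obtain ⟨w, rfl⟩ := exists_planeLine_eq hl
    exact ⟨⟨w, hQ⟩, rfl⟩

theorem card_points_isLine {l : Submodule K (Fin 3 → K)} (hl : IsLine l) :
    Nat.card {p : ℙ K (Fin 3 → K) // p.rep ∈ l} = Fintype.card K + 1 := by
  obtain ⟨w, rfl⟩ := exists_planeLine_eq hl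
  simp_rw [rep_mem_planeLine]
  exact (ProjectivePlane.pointCount_eq (ℙ K (Fin 3 → K)) w).trans
    (congrArg (· + 1) order_projectivization)

/-- A tangent line does not meet a curve of degree `d` in exactly `d ≤ q` rational points. -/
theorem card_tangent_inter_ne {d : ℕ} {G : MvPolynomial (Fin 3) K} (hG : G.IsHomogeneous d)
    (hd : d < Fintype.card K + 1) {p : ℙ K (Fin 3 → K)} (hp : eval p.rep G = 0)
    {l : Submodule K (Fin 3 → K)} (hl : IsLine l) (hpl : p.rep ∈ l)
    (htan : ∀ v ∈ l, ∑ i, eval p.rep (pderiv i G) * v i = 0) :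
    Nat.card {x : ℙ K (Fin 3 → K) // x.rep ∈ l ∧ eval x.rep G = 0} ≠ d := by
  classical
  have : Fintype (ℙ K (Fin 3 → K)) := Fintype.ofFinite _
  intro hcard
  obtain ⟨r, hrl, hr⟩ : ∃ r : ℙ K (Fin 3 → K), r.rep ∈ l ∧ eval r.rep G ≠ 0 := by
    by_contra! hall
    have h1 := card_points_isLine hl
    rw [← Nat.card_congr (Equiv.subtypeEquivRight fun x => and_iff_left_of_imp (hall x)),
      hcard] at h1
    omega
  have hpr : p ≠ r := by
    rintro rfl
    exact hr hp
  set g := lineRestrict p.rep r.rep G with hgdef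
  have hg : g ≠ 0 := by
    intro h0
    apply hr
    rw [← coeff_lineRestrict p.rep r.rep hG, ← hgdef, h0, Polynomial.coeff_zero]
  have hne : ∀ t : K, p.rep + t • r.rep ≠ 0 := by
    intro t h0
    apply hpr
    rw [← p.mk_rep, ← r.mk_rep, mk_eq_mk_iff']
    exact ⟨-t, by rw [neg_smul, ← eq_neg_of_add_eq_zero_left h0]⟩
  rw [Nat.card_eq_fintype_card, Fintype.card_subtype] at hcard
  set A : Finset (ℙ K (Fin 3 → K)) := {x | x.rep ∈ l ∧ eval x.rep G = 0} with hA
  have hpA : p ∈ A := by simp [hA, hp, hpl]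
  have hsub : A.erase p ⊆
      ({t : K | t ≠ 0 ∧ g.eval t = 0} : Finset K).image fun t => mk K _ (hne t) := by
    intro x hx
    obtain ⟨hxp, hxA⟩ := Finset.mem_erase.mp hx
    obtain ⟨hxl, hxG⟩ := (Finset.mem_filter.mp hxA).2
    rw [← span_pair_rep_eq hl hpr hpl hrl, Submodule.mem_span_pair] at hxl
    obtain ⟨α, β, hαβ⟩ := hxl
    have hα : α ≠ 0 := by
      rintro rfl
      rw [zero_smul, zero_add] at hαβ
      rw [← hαβ, hG.eval_smul] at hxG
      have hβ : β ≠ 0 := by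
        rintro rfl
        exact x.rep_nonzero (by rw [← hαβ, zero_smul])
      exact (mul_ne_zero (pow_ne_zero _ hβ) hr) hxG
    have hβ : β ≠ 0 := by
      rintro rfl
      apply hxp
      rw [← x.mk_rep, ← p.mk_rep, mk_eq_mk_iff']
      exact ⟨α, by rw [← hαβ, zero_smul, add_zero]⟩
    have hx' : α • (p.rep + (β / α) • r.rep) = x.rep := by
      rw [← hαβ, smul_add, smul_smul, mul_div_cancel₀ _ hα]
    refine Finset.mem_image.mpr ⟨β / α, ?_, ?_⟩
    · simp only [Finset.mem_filter, Finset.mem_univ, true_and]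
      refine ⟨div_ne_zero hβ hα, ?_⟩
      rw [hgdef, eval_lineRestrict]
      rw [← hx', hG.eval_smul] at hxG
      exact (mul_eq_zero.mp hxG).resolve_left (pow_ne_zero _ hα)
    · rw [← x.mk_rep, mk_eq_mk_iff']
      exact ⟨α⁻¹, by rw [← hx', smul_smul, inv_mul_cancel₀ hα, one_smul]⟩
  have h1 := (Finset.card_le_card hsub).trans Finset.card_image_le
  rw [Finset.card_erase_of_mem hpA, hcard] at h1
  have h2 := Polynomial.card_add_two_le_natDegree hg
    (by rw [hgdef, eval_lineRestrict, zero_smul, add_zero, hp])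
    (by rw [hgdef, eval_zero_derivative_lineRestrict]; exact htan _ hrl)
    (T := ({t : K | t ≠ 0 ∧ g.eval t = 0} : Finset K)) (fun t ht => (Finset.mem_filter.mp ht).2)
  have h3 := natDegree_lineRestrict_le p.rep r.rep hG
  rw [← hgdef] at h3
  omega

end PlaneLines

theorem exists_linForm_dvd_of_isHomogeneous_one {n : ℕ} {G : MvPolynomial (Fin n) K}
    (hG : G.IsHomogeneous 1) (h0 : G ≠ 0) : ∃ a : Fin n → K, a ≠ 0 ∧ linForm a ∣ G := by
  have hlin : G = linForm fun i => coeff 0 (pderiv i G) := by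
    have h := hG.sum_X_mul_pderiv
    rw [one_smul] at h
    conv_lhs => rw [← h]
    refine Finset.sum_congr rfl fun i _ => ?_
    have hp : (pderiv i G).IsHomogeneous 0 := hG.pderiv
    rw [mul_comm, ← totalDegree_eq_zero_iff_eq_C.mp ((totalDegree_zero_iff_isHomogeneous _).mpr hp)]
  refine ⟨_, fun ha => h0 ?_, dvd_of_eq hlin.symm⟩
  rw [hlin, ha]
  simp [linForm]

/-- Let `C` be a plane curve of degree `d < q+1` over `F_q` without
`F_q`-line components attaining the Sziklai bound `N_q(C) = (d-1)q + 1`, with no singular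
`F_q`-point, such that every `F_q`-line meets `C(F_q)` in `0`, `1` or `d` points. Then:
(a) a line meeting `C(F_q)` meets it in exactly one point iff it is the tangent line to
`C` at an `F_q`-point of `C`; (b) there are exactly `(d-1)q + 1` lines meeting `C(F_q)`
in one point and `((d-1)q + 1)q/d` lines meeting it in `d` points; consequently
`d ≤ √q + 1`. -/
theorem tangent_count_and_degree_bound (K : Type) [Field K] [Fintype K]
    (d : ℕ) (G : MvPolynomial (Fin 3) K)
    (hhom : G.IsHomogeneous d) (hsf : Squarefree G)
    (hnoline : ¬ ∃ a : Fin 3 → K, a ≠ 0 ∧ linForm a ∣ G)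
    (hN : Nat.card {p : Projectivization K (Fin 3 → K) // MvPolynomial.eval p.rep G = 0} =
      (d - 1) * Fintype.card K + 1)
    (hd : d < Fintype.card K + 1)
    (hns : ∀ p : Projectivization K (Fin 3 → K), MvPolynomial.eval p.rep G = 0 →
      ∃ i, MvPolynomial.eval p.rep (MvPolynomial.pderiv i G) ≠ 0)
    (hlines : ∀ l : Submodule K (Fin 3 → K), IsLine l →
      Nat.card {p : Projectivization K (Fin 3 → K) //
          p.rep ∈ l ∧ MvPolynomial.eval p.rep G = 0} = 0 ∨
      Nat.card {p : Projectivization K (Fin 3 → K) //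
          p.rep ∈ l ∧ MvPolynomial.eval p.rep G = 0} = 1 ∨
      Nat.card {p : Projectivization K (Fin 3 → K) //
          p.rep ∈ l ∧ MvPolynomial.eval p.rep G = 0} = d) :
    (∀ l : Submodule K (Fin 3 → K), IsLine l →
      (∃ p : Projectivization K (Fin 3 → K),
          p.rep ∈ l ∧ MvPolynomial.eval p.rep G = 0) →
      (Nat.card {p : Projectivization K (Fin 3 → K) //
          p.rep ∈ l ∧ MvPolynomial.eval p.rep G = 0} = 1 ↔
        ∃ p : Projectivization K (Fin 3 → K), MvPolynomial.eval p.rep G = 0 ∧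
          l = LinearMap.ker
            (linMap (fun i => MvPolynomial.eval p.rep (MvPolynomial.pderiv i G))))) ∧
    Nat.card {l : Submodule K (Fin 3 → K) // IsLine l ∧
        Nat.card {p : Projectivization K (Fin 3 → K) //
          p.rep ∈ l ∧ MvPolynomial.eval p.rep G = 0} = 1} =
      (d - 1) * Fintype.card K + 1 ∧
    Nat.card {l : Submodule K (Fin 3 → K) // IsLine l ∧
        Nat.card {p : Projectivization K (Fin 3 → K) //
          p.rep ∈ l ∧ MvPolynomial.eval p.rep G = 0} = d} * d =
      ((d - 1) * Fintype.card K + 1) * Fintype.card K ∧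
    (d : ℝ) ≤ Real.sqrt (Fintype.card K) + 1 := by
  classical
  have : Fintype (Projectivization K (Fin 3 → K)) := Fintype.ofFinite _
  set S : Finset (Projectivization K (Fin 3 → K)) := {p | eval p.rep G = 0} with hSdef
  have hG0 : G ≠ 0 := fun h => by
    obtain ⟨p⟩ : Nonempty (Projectivization K (Fin 3 → K)) := inferInstance
    obtain ⟨i, hi⟩ := hns p (by simp [h])
    simp [h] at hi
  have hd2 : 2 ≤ d := by
    by_contra hlt
    obtain rfl | rfl : d = 0 ∨ d = 1 := by omega
    · obtain ⟨c, rfl⟩ : ∃ c, G = C c := ⟨_, totalDegree_eq_zero_iff_eq_C.mp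
        ((totalDegree_zero_iff_isHomogeneous _).mpr hhom)⟩
      have hc : c ≠ 0 := fun h => hG0 (by rw [h, C_0])
      simp [hc] at hN
    · exact hnoline (exists_linForm_dvd_of_isHomogeneous_one hhom hG0)
  have hcount : ∀ w : Projectivization K (Fin 3 → K),
      Nat.card {p : Projectivization K (Fin 3 → K) //
        p.rep ∈ planeLine w ∧ eval p.rep G = 0} = (S.filter fun p => p ∈ w).card := by
    intro w
    rw [Nat.card_eq_fintype_card, Fintype.card_subtype, hSdef, Finset.filter_filter]
    simp_rw [rep_mem_planeLine, and_comm]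
  have hS : S.card = (d - 1) * Configuration.ProjectivePlane.order
      (Projectivization K (Fin 3 → K)) (Projectivization K (Fin 3 → K)) + 1 := by
    rw [order_projectivization, ← hN, Nat.card_eq_fintype_card, Fintype.card_subtype]
  have hm : ∀ w : Projectivization K (Fin 3 → K), (S.filter fun p => p ∈ w).card = 0 ∨
      (S.filter fun p => p ∈ w).card = 1 ∨ (S.filter fun p => p ∈ w).card = d := by
    intro w
    rw [← hcount]
    exact hlines _ (isLine_planeLine w)
  have hthrough := fun p (hp : p ∈ S) =>
    Configuration.ProjectivePlane.card_lines_through_of_inter hd2 hS hm hp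
  have hgrad : ∀ p : Projectivization K (Fin 3 → K), eval p.rep G = 0 →
      (fun i => eval p.rep (pderiv i G)) ≠ 0 := fun p hp h => by
    obtain ⟨i, hi⟩ := hns p hp
    exact hi (congrFun h i)
  have hmemtan : ∀ p : Projectivization K (Fin 3 → K), eval p.rep G = 0 →
      p.rep ∈ LinearMap.ker (linMap fun i => eval p.rep (pderiv i G)) := fun p hp => by
    have h := congrArg (eval p.rep) hhom.sum_X_mul_pderiv
    rw [map_sum, map_nsmul, hp, smul_zero] at h
    rw [LinearMap.mem_ker, linMap_apply, ← h, dotProduct]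
    exact Finset.sum_congr rfl fun i _ => by rw [map_mul, eval_X, mul_comm]
  have htangent : ∀ p : Projectivization K (Fin 3 → K), eval p.rep G = 0 →
      Nat.card {x : Projectivization K (Fin 3 → K) //
        x.rep ∈ LinearMap.ker (linMap fun i => eval p.rep (pderiv i G)) ∧
          eval x.rep G = 0} = 1 := by
    intro p hp
    have hl := isLine_ker_linMap (hgrad p hp)
    have hne := card_tangent_inter_ne hhom hd hp hl (hmemtan p hp) fun v hv => by
      rw [LinearMap.mem_ker, linMap_apply] at hv
      exact hv
    have hpos : 0 < Nat.card {x : Projectivization K (Fin 3 → K) //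
        x.rep ∈ LinearMap.ker (linMap fun i => eval p.rep (pderiv i G)) ∧
          eval x.rep G = 0} :=
      Finite.card_pos_iff.mpr ⟨⟨p, hmemtan p hp, hp⟩⟩
    have := hlines _ hl
    omega
  refine ⟨fun l hl ⟨p, hpl, hp⟩ => ⟨fun h1 => ⟨p, hp, ?_⟩, ?_⟩, ?_, ?_, ?_⟩
  · obtain ⟨w, rfl⟩ := exists_planeLine_eq hl
    obtain ⟨w', hw'⟩ := exists_planeLine_eq (isLine_ker_linMap (hgrad p hp))
    have h2 := htangent p hp
    have hp2 := hmemtan p hp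
    rw [← hw'] at h2 hp2 ⊢
    rw [hcount] at h1 h2
    rw [rep_mem_planeLine] at hpl hp2
    have hle := Finset.card_le_one.mp (hthrough p (by simp [hSdef, hp])).1.le
    rw [hle w (by simp [hpl, h1]) w' (by simp [hp2, h2])]
  · rintro ⟨r, hr, rfl⟩
    exact htangent r hr
  · rw [card_isLine_and]
    simp_rw [hcount]
    rw [Nat.card_eq_fintype_card, Fintype.card_subtype, ← order_projectivization, ← hS]
    simpa using Configuration.ProjectivePlane.card_lines_mul_of_inter
      fun p hp => (hthrough p hp).1
  · rw [card_isLine_and]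
    simp_rw [hcount]
    rw [Nat.card_eq_fintype_card, Fintype.card_subtype, ← order_projectivization, ← hS]
    exact Configuration.ProjectivePlane.card_lines_mul_of_inter fun p hp => (hthrough p hp).2
  · have h := Configuration.ProjectivePlane.sq_sub_one_le_order hd2 hS hm
    rw [order_projectivization] at h
    have h' : ((d : ℝ) - 1) ^ 2 ≤ Fintype.card K := by
      have : ((d - 1 : ℕ) : ℝ) = (d : ℝ) - 1 := by push_cast [show 1 ≤ d by omega]; ring
      rw [← this]
      exact_mod_cast h
    linarith [Real.le_sqrt_of_sq_le h']
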